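/- Let h_1 ≥ h_2 ≥ h_3 ≥ h_4 > 0 be integers. A realization LS(h_1 h_2 h_3 h_4) exists if and only if h_1 = h_2 = h_3, or h_2 = h_3 = h_4 with h_1 ≤ 2h_4. -/

import Mathlib

/-- A latin square of order `n`: an `n × n` array with symbols from a set of
size `n` (encoded as `Fin n`) such that every symbol occurs exactly once in
every row and every column. -/
def IsLatinSquare {n : ℕ} (L : Fin n → Fin n → Fin n) : Prop :=
  (∀ i, Function.Bijective fun j => L i j) ∧ (∀ j, Function.Bijective fun i => L i j)

/-- `L` has pairwise disjoint subsquares of orders `h 0, …, h (k-1)`: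
for each `i` there are sets `R i` of rows, `C i` of columns and `S i` of
symbols, each of size `h i`, pairwise disjoint (no shared rows, columns or
symbols), such that the subarray on rows `R i` and columns `C i` only uses
the symbols `S i` (given that `L` is a latin square, this subarray is then
itself a latin square of order `h i` on the symbol set `S i`). -/
def HasDisjointSubsquares {n k : ℕ} (L : Fin n → Fin n → Fin n) (h : Fin k → ℕ) : Prop :=
  ∃ R C S : Fin k → Finset (Fin n),
    (∀ i, (R i).card = h i) ∧ (∀ i, (C i).card = h i) ∧ (∀ i, (S i).card = h i) ∧
    (∀ i j, i ≠ j → Disjoint (R i) (R j)) ∧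
    (∀ i j, i ≠ j → Disjoint (C i) (C j)) ∧
    (∀ i j, i ≠ j → Disjoint (S i) (S j)) ∧
    (∀ i, ∀ x ∈ R i, ∀ y ∈ C i, L x y ∈ S i)

/-- An incomplete latin square `ILS(n; h_1 … h_k)`: a latin square of order `n`
with pairwise disjoint subsquares of orders `h_1, …, h_k`. -/
def HasILS (n : ℕ) {k : ℕ} (h : Fin k → ℕ) : Prop :=
  ∃ L : Fin n → Fin n → Fin n, IsLatinSquare L ∧ HasDisjointSubsquares L h

/-- A realization of the partition `(h_1 … h_k)` of `n = h_1 + … + h_k`: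
a latin square of order `n` with pairwise disjoint subsquares of orders
`h_1, …, h_k`. -/
def HasRealization {k : ℕ} (h : Fin k → ℕ) : Prop :=
  HasILS (∑ i, h i) h


open Finset in
/-- If every fibre of `f` on `S` has `d` elements, the preimage of `X` in `S` has `#X * d`. -/
theorem card_filter_mem_of_card_fiber {E A : Type*} [DecidableEq A] (f : E → A) {d : ℕ}
    (S : Finset E) (hf : ∀ a, #{e ∈ S | f e = a} = d) (X : Finset A) :
    #{e ∈ S | f e ∈ X} = #X * d := by
  rw [card_eq_sum_card_fiberwise (f := f) (t := X) (by intro e he; simp_all)]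
  rw [sum_congr rfl (g := fun _ => d)]
  · simp
  · intro a ha
    rw [← hf a, filter_filter]
    congr 1
    ext e
    simp only [mem_filter]
    grind

open Finset in
/-- A regular bipartite multigraph, with edges the elements of `S` and endpoint maps `f`, `g`,
has a perfect matching. -/
theorem exists_matching_of_regular {E A B : Type*} [Finite A] [Finite B] [DecidableEq E]
    [DecidableEq A] [DecidableEq B] (f : E → A) (g : E → B) {d : ℕ} (hd : 0 < d) (S : Finset E)
    (hf : ∀ a, #{e ∈ S | f e = a} = d) (hg : ∀ b, #{e ∈ S | g e = b} = d) :
    ∃ m : A → E, (∀ a, m a ∈ S) ∧ (∀ a, f (m a) = a) ∧ Function.Bijective (g ∘ m) := by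
  have := Fintype.ofFinite A
  have := Fintype.ofFinite B
  have hall : ∀ X : Finset A,
      #X ≤ #(X.biUnion fun a => ({e ∈ S | f e = a}).image g) := by
    intro X
    set Y := X.biUnion fun a => ({e ∈ S | f e = a}).image g with hY
    have h3 : #{e ∈ S | f e ∈ X} ≤ #{e ∈ S | g e ∈ Y} := by
      apply card_le_card
      intro e he
      simp only [mem_filter, hY, mem_biUnion, mem_image] at he ⊢
      exact ⟨he.1, f e, he.2, e, ⟨he.1, rfl⟩, rfl⟩
    rw [card_filter_mem_of_card_fiber f S hf, card_filter_mem_of_card_fiber g S hg] at h3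
    exact Nat.le_of_mul_le_mul_right h3 hd
  obtain ⟨φ, hφ, hφm⟩ := (all_card_le_biUnion_card_iff_exists_injective _).1 hall
  simp only [mem_image, mem_filter] at hφm
  choose m hm hgm using hφm
  refine ⟨m, fun a => (hm a).1, fun a => (hm a).2, ?_⟩
  have hgm' : g ∘ m = φ := funext hgm
  rw [hgm', Fintype.bijective_iff_injective_and_card]
  refine ⟨hφ, ?_⟩
  have hA := card_filter_mem_of_card_fiber f S hf univ
  have hB := card_filter_mem_of_card_fiber g S hg univ
  simp only [mem_univ, filter_true, card_univ] at hA hB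
  exact Nat.eq_of_mul_eq_mul_right hd (hA.symm.trans hB)

open Finset in
/-- Removing a transversal `T` of the fibres of `k` lowers every fibre size by one. -/
theorem card_fiber_sdiff {E D : Type*} [DecidableEq E] [DecidableEq D] (k : E → D) {d : ℕ}
    {S T : Finset E} (hk : ∀ x, #{e ∈ S | k e = x} = d + 1)
    (hT : ∀ x, ∃ e ∈ S, e ∈ T ∧ k e = x ∧ ∀ e' ∈ T, k e' = x → e' = e) (x : D) :
    #{e ∈ S \ T | k e = x} = d := by
  obtain ⟨e, heS, heT, hex, he⟩ := hT x
  have : ({e ∈ S \ T | k e = x} : Finset E) = ({e ∈ S | k e = x} : Finset E).erase e := by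
    ext e'
    simp only [mem_filter, mem_sdiff, mem_erase]
    grind
  rw [this, card_erase_of_mem (by simp [heS, hex]), hk]
  simp

open Finset in
/-- Giving a transversal `T` of the fibres of `k` the new colour `d` extends a proper colouring
of the remaining edges. -/
theorem card_fiber_extend_coloring {E D : Type*} [DecidableEq E] [DecidableEq D] (k : E → D)
    {d : ℕ} {S T : Finset E} {c : E → ℕ} (hc : ∀ e ∈ S \ T, c e < d)
    (hck : ∀ t < d, ∀ x, #{e ∈ S \ T | k e = x ∧ c e = t} = 1)
    (hT : ∀ x, ∃ e ∈ S, e ∈ T ∧ k e = x ∧ ∀ e' ∈ T, k e' = x → e' = e)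
    (t : ℕ) (ht : t < d + 1) (x : D) :
    #{e ∈ S | k e = x ∧ (if e ∈ T then d else c e) = t} = 1 := by
  rcases (Nat.lt_succ_iff_lt_or_eq.1 ht) with ht | rfl
  · rw [← hck t ht x]
    congr 1
    ext e
    simp only [mem_filter, mem_sdiff]
    grind
  · obtain ⟨e, heS, heT, hex, he⟩ := hT x
    rw [card_eq_one]
    refine ⟨e, ?_⟩
    ext e'
    simp only [mem_filter, mem_singleton]
    simp only [mem_sdiff] at hc
    grind

open Finset in
/-- A `d`-regular bipartite multigraph has a proper edge colouring with `d` colours. -/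
theorem exists_edge_coloring_of_regular {E A B : Type*} [Finite A] [Finite B] [DecidableEq E]
    [DecidableEq A] [DecidableEq B] (f : E → A) (g : E → B) (d : ℕ) (S : Finset E)
    (hf : ∀ a, #{e ∈ S | f e = a} = d) (hg : ∀ b, #{e ∈ S | g e = b} = d) :
    ∃ c : E → ℕ, (∀ e ∈ S, c e < d) ∧ (∀ t < d, ∀ a, #{e ∈ S | f e = a ∧ c e = t} = 1) ∧
      (∀ t < d, ∀ b, #{e ∈ S | g e = b ∧ c e = t} = 1) := by
  have := Fintype.ofFinite A
  induction d generalizing S with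
  | zero =>
    refine ⟨fun _ => 0, fun e he => ?_, by simp, by simp⟩
    have := hf (f e)
    rw [card_eq_zero, filter_eq_empty_iff] at this
    exact absurd rfl (this he)
  | succ d ih =>
    obtain ⟨m, hmS, hfm, hgm⟩ := exists_matching_of_regular f g d.succ_pos S hf hg
    set T : Finset E := univ.image m with hT
    have hfT : ∀ a, ∃ e ∈ S, e ∈ T ∧ f e = a ∧ ∀ e' ∈ T, f e' = a → e' = e := by
      intro a
      refine ⟨m a, hmS a, by simp [hT], hfm a, ?_⟩
      simp only [hT, mem_image, mem_univ, true_and]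
      rintro _ ⟨a', rfl⟩ h
      rw [hfm] at h
      rw [h]
    have hgT : ∀ b, ∃ e ∈ S, e ∈ T ∧ g e = b ∧ ∀ e' ∈ T, g e' = b → e' = e := by
      intro b
      obtain ⟨a, ha⟩ := hgm.2 b
      refine ⟨m a, hmS a, by simp [hT], ha, ?_⟩
      simp only [hT, mem_image, mem_univ, true_and]
      rintro _ ⟨a', rfl⟩ h
      rw [hgm.1 (h.trans ha.symm)]
    obtain ⟨c, hc, hcf, hcg⟩ :=
      ih (S \ T) (card_fiber_sdiff f hf hfT) (card_fiber_sdiff g hg hgT)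
    refine ⟨fun e => if e ∈ T then d else c e, fun e he => ?_,
      card_fiber_extend_coloring f hc hcf hfT, card_fiber_extend_coloring g hc hcg hgT⟩
    simp only [mem_sdiff] at hc
    grind

open Finset in
/-- Fibres of sizes `d * p a` can be cut into `p a` pieces of size `d`. -/
theorem exists_split_fibers {E A : Type*} [Fintype E] [DecidableEq E] [DecidableEq A]
    (f : E → A) (d : ℕ) (p : A → ℕ) (hf : ∀ a, #{e | f e = a} = d * p a) :
    ∃ F : E → Σ a, Fin (p a), (∀ e, (F e).1 = f e) ∧ ∀ x, #{e | F e = x} = d := by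
  have hcard : ∀ a, Nonempty ({e // f e = a} ≃ Fin (p a) × Fin d) := by
    intro a
    rw [← Fintype.card_eq, Fintype.card_subtype, hf a]
    simp [mul_comm]
  have φ := fun a => (hcard a).some
  refine ⟨fun e => ⟨f e, (φ (f e) ⟨e, rfl⟩).1⟩, fun _ => rfl, ?_⟩
  rintro ⟨a, s⟩
  have himage : ({e | (⟨f e, (φ (f e) ⟨e, rfl⟩).1⟩ : Σ a, Fin (p a)) = ⟨a, s⟩} : Finset E) =
      univ.image fun t : Fin d => ((φ a).symm (s, t)).1 := by
    ext e
    simp only [mem_filter, mem_univ, true_and, mem_image]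
    constructor
    · intro h
      obtain ⟨rfl, h⟩ := Sigma.mk.inj_iff.1 h
      refine ⟨(φ (f e) ⟨e, rfl⟩).2, ?_⟩
      rw [← eq_of_heq h]
      simp
    · rintro ⟨t, rfl⟩
      have hmk : ∀ (e : E) (h : f e = a),
          (⟨f e, (φ (f e) ⟨e, rfl⟩).1⟩ : Σ a, Fin (p a)) = ⟨a, (φ a ⟨e, h⟩).1⟩ := by
        rintro e rfl
        rfl
      rw [hmk _ ((φ a).symm (s, t)).2]
      simp
  rw [himage, card_image_of_injective, card_univ, Fintype.card_fin]
  intro t t' h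
  simpa using (φ a).symm.injective (Subtype.ext h)

open Finset in
/-- If `P` meets every fibre of `F` once, it meets the fibre of `a` under the first projection
`p a` times. -/
theorem card_fst_eq_of_card_fiber_eq_one {E A : Type*} [Fintype E] [DecidableEq A]
    {p : A → ℕ} (F : E → Σ a, Fin (p a)) (P : E → Prop) [DecidablePred P]
    (h : ∀ x, #{e | F e = x ∧ P e} = 1) (a : A) : #{e | P e ∧ (F e).1 = a} = p a := by
  rw [card_eq_sum_card_fiberwise (f := F) (t := univ.map ⟨Sigma.mk a, sigma_mk_injective⟩)]
  · rw [sum_map, sum_congr rfl (g := fun _ => 1)]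
    · simp
    · intro s _
      rw [← h ⟨a, s⟩, filter_filter]
      congr 1
      ext e
      simp only [mem_filter, mem_univ, true_and, Function.Embedding.coeFn_mk]
      constructor
      · rintro ⟨⟨h1, -⟩, h2⟩
        exact ⟨h2, h1⟩
      · rintro ⟨h1, h2⟩
        exact ⟨⟨h2, by rw [h1]⟩, h1⟩
  · intro e he
    simp only [coe_filter, mem_univ, true_and, Set.mem_ofPred_eq] at he
    simp only [coe_map, Function.Embedding.coeFn_mk, coe_univ, Set.image_univ, Set.mem_range]
    obtain ⟨-, rfl⟩ := he
    exact ⟨(F e).2, rfl⟩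

open Finset in
/-- Equitable edge colouring: if the degrees of a bipartite multigraph are `d * p a` and
`d * q b`, its edges can be coloured with `d` colours so that each colour class has degrees
`p a` and `q b`. -/
theorem exists_equitable_coloring {E A B : Type*} [Fintype E] [Finite A] [Finite B]
    [DecidableEq A] [DecidableEq B] (f : E → A) (g : E → B) (d : ℕ) (p : A → ℕ) (q : B → ℕ)
    (hf : ∀ a, #{e | f e = a} = d * p a) (hg : ∀ b, #{e | g e = b} = d * q b) :
    ∃ c : E → Fin d, (∀ t a, #{e | c e = t ∧ f e = a} = p a) ∧
      (∀ t b, #{e | c e = t ∧ g e = b} = q b) := by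
  classical
  obtain ⟨F, hFf, hF⟩ := exists_split_fibers f d p hf
  obtain ⟨G, hGg, hG⟩ := exists_split_fibers g d q hg
  obtain ⟨c, hc, hcF, hcG⟩ := exists_edge_coloring_of_regular F G d univ hF hG
  refine ⟨fun e => ⟨c e, hc e (mem_univ e)⟩, fun t a => ?_, fun t b => ?_⟩
  · simp only [← hFf, Fin.ext_iff]
    exact card_fst_eq_of_card_fiber_eq_one F (fun e => c e = t) (hcF t t.2) a
  · simp only [← hGg, Fin.ext_iff]
    exact card_fst_eq_of_card_fiber_eq_one G (fun e => c e = t) (hcG t t.2) b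

open Finset in
/-- The classes of `r`, of weights `w i`, can be split into `w i` classes each, so that the
incidences with the classes of `f` and of `g` are divided evenly. -/
theorem exists_refinement {E I A B : Type*} [Fintype E] [Finite A] [Finite B] [DecidableEq I]
    [DecidableEq A] [DecidableEq B] (r : E → I) (f : E → A) (g : E → B)
    (w : I → ℕ) (p : A → ℕ) (q : B → ℕ)
    (hf : ∀ i a, #{e | r e = i ∧ f e = a} = w i * p a)
    (hg : ∀ i b, #{e | r e = i ∧ g e = b} = w i * q b) :
    ∃ r' : E → Σ i, Fin (w i), (∀ e, (r' e).1 = r e) ∧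
      (∀ x a, #{e | r' e = x ∧ f e = a} = p a) ∧ (∀ x b, #{e | r' e = x ∧ g e = b} = q b) := by
  have hsub : ∀ (i : I) (P : E → Prop) [DecidablePred P],
      #{e : {e // r e = i} | P e} = #{e | r e = i ∧ P e} := by
    intro i P _
    rw [← card_map (Function.Embedding.subtype _)]
    congr 1
    ext e
    simp [and_comm]
  choose c hcf hcg using fun i => exists_equitable_coloring
    (fun e : {e // r e = i} => f e) (fun e => g e) (w i) p q
    (fun a => by rw [hsub i (fun e => f e = a), hf])
    (fun b => by rw [hsub i (fun e => g e = b), hg])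
  have hcount : ∀ (i : I) (t : Fin (w i)) (P : E → Prop) [DecidablePred P],
      #{e | (⟨r e, c (r e) ⟨e, rfl⟩⟩ : Σ i, Fin (w i)) = ⟨i, t⟩ ∧ P e} =
        #{e : {e // r e = i} | c i e = t ∧ P e} := by
    intro i t P _
    symm
    rw [← card_map (Function.Embedding.subtype _)]
    congr 1
    ext e
    simp only [mem_map, mem_filter, mem_univ, true_and, Function.Embedding.subtype_apply]
    constructor
    · rintro ⟨⟨e, rfl⟩, ⟨rfl, h⟩, rfl⟩
      exact ⟨rfl, h⟩
    · rintro ⟨h, hP⟩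
      obtain ⟨rfl, h⟩ := Sigma.mk.inj_iff.1 h
      exact ⟨⟨e, rfl⟩, ⟨eq_of_heq h, hP⟩, rfl⟩
  refine ⟨fun e => ⟨r e, c (r e) ⟨e, rfl⟩⟩, fun _ => rfl, ?_, ?_⟩
  · rintro ⟨i, t⟩ a
    rw [hcount i t (fun e => f e = a), hcf]
  · rintro ⟨i, t⟩ b
    rw [hcount i t (fun e => g e = b), hcg]

open Finset in
/-- An array in which each row and column, each row and symbol, and each column and symbol
determine exactly one cell is a latin square; disjoint subsquares are recovered from classes. -/
theorem hasRealization_of_cells {E : Type*} [Fintype E] {k : ℕ} (h : Fin k → ℕ)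
    (r c s : E → Σ i, Fin (h i))
    (hrc : ∀ x y, #{e | r e = x ∧ c e = y} = 1)
    (hrs : ∀ x z, #{e | r e = x ∧ s e = z} = 1)
    (hcs : ∀ y z, #{e | c e = y ∧ s e = z} = 1)
    (hdiag : ∀ e, (r e).1 = (c e).1 → (s e).1 = (r e).1) : HasRealization h := by
  simp only [card_eq_one, Finset.ext_iff, mem_filter, mem_univ, true_and, mem_singleton]
    at hrc hrs hcs
  choose cell hcell using hrc
  have hcr : ∀ x y, r (cell x y) = x := fun x y => ((hcell x y _).2 rfl).1
  have hcc : ∀ x y, c (cell x y) = y := fun x y => ((hcell x y _).2 rfl).2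
  have hcu : ∀ e, cell (r e) (c e) = e := fun e => ((hcell _ _ e).1 ⟨rfl, rfl⟩).symm
  have hrow : ∀ x, Function.Bijective fun y => s (cell x y) := by
    intro x
    constructor
    · intro y y' hyy
      obtain ⟨e, he⟩ := hrs x (s (cell x y))
      rw [← hcc x y, ← hcc x y', (he _).1 ⟨hcr x y, rfl⟩, (he _).1 ⟨hcr x y', hyy.symm⟩]
    · intro z
      obtain ⟨e, he⟩ := hrs x z
      obtain ⟨rfl, rfl⟩ := (he e).2 rfl
      exact ⟨c e, by simp [hcu]⟩
  have hcol : ∀ y, Function.Bijective fun x => s (cell x y) := by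
    intro y
    constructor
    · intro x x' hxx
      obtain ⟨e, he⟩ := hcs y (s (cell x y))
      rw [← hcr x y, ← hcr x' y, (he _).1 ⟨hcc x y, rfl⟩, (he _).1 ⟨hcc x' y, hxx.symm⟩]
    · intro z
      obtain ⟨e, he⟩ := hcs y z
      obtain ⟨rfl, rfl⟩ := (he e).2 rfl
      exact ⟨r e, by simp [hcu]⟩
  let φ : (Σ i, Fin (h i)) ≃ Fin (∑ i, h i) := finSigmaFinEquiv
  let cls : Fin k → Finset (Fin (∑ i, h i)) := fun i => {x | (φ.symm x).1 = i}
  have hcls : ∀ i, #(cls i) = h i := by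
    intro i
    have : cls i = univ.image fun t => φ ⟨i, t⟩ := by
      ext x
      obtain ⟨⟨j, t⟩, rfl⟩ := φ.surjective x
      simp only [cls, mem_filter, mem_univ, true_and, Equiv.symm_apply_apply, mem_image,
        EmbeddingLike.apply_eq_iff_eq]
      constructor
      · rintro rfl
        exact ⟨t, rfl⟩
      · rintro ⟨t', h'⟩
        exact (congrArg Sigma.fst h').symm
    rw [this]
    exact (card_image_of_injective _ (φ.injective.comp sigma_mk_injective)).trans (by simp)
  have hdisj : ∀ i j, i ≠ j → Disjoint (cls i) (cls j) := by
    intro i j hij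
    rw [disjoint_left]
    simp only [cls, mem_filter, mem_univ, true_and]
    rintro x rfl
    exact hij
  refine ⟨fun x y => φ (s (cell (φ.symm x) (φ.symm y))), ⟨fun x => ?_, fun y => ?_⟩,
    cls, cls, cls, hcls, hcls, hcls, hdisj, hdisj, hdisj, ?_⟩
  · exact φ.bijective.comp ((hrow _).comp φ.symm.bijective)
  · exact φ.bijective.comp ((hcol (φ.symm y)).comp φ.symm.bijective)
  · intro i x hx y hy
    simp only [cls, mem_filter, mem_univ, true_and, Equiv.symm_apply_apply] at hx hy ⊢
    rw [hdiag _ (by rw [hcr, hcc, hx, hy]), hcr, hx]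

open Finset in
/-- Every outline latin square whose diagonal blocks are subsquares is an amalgamation of a latin
square realizing `h`: here `N i j l` is the number of cells in block `(i, j)` with a symbol of
class `l`. -/
theorem hasRealization_of_outline {k : ℕ} (h : Fin k → ℕ) (N : Fin k → Fin k → Fin k → ℕ)
    (hrc : ∀ i j, ∑ l, N i j l = h i * h j) (hrs : ∀ i l, ∑ j, N i j l = h i * h l)
    (hcs : ∀ j l, ∑ i, N i j l = h j * h l) (hdiag : ∀ i l, l ≠ i → N i i l = 0) :
    HasRealization h := by
  let E := Σ t : Fin k × Fin k × Fin k, Fin (N t.1 t.2.1 t.2.2)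
  have hE : ∀ P : Fin k × Fin k × Fin k → Prop, ∀ [DecidablePred P],
      #{e : E | P e.1} = ∑ i, ∑ j, ∑ l, if P (i, j, l) then N i j l else 0 := by
    intro P _
    rw [card_filter, Fintype.sum_sigma, Fintype.sum_prod_type]
    refine sum_congr rfl fun i _ => ?_
    rw [Fintype.sum_prod_type]
    refine sum_congr rfl fun j _ => sum_congr rfl fun l _ => ?_
    split_ifs <;> simp
  obtain ⟨r, hr, hrc', hrs'⟩ := exists_refinement (fun e : E => e.1.1) (fun e => e.1.2.1)
    (fun e => e.1.2.2) h h h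
    (fun i j => by
      rw [hE (fun t => t.1 = i ∧ t.2.1 = j), ← hrc]
      rw [Fintype.sum_eq_single i (by simp +contextual),
        Fintype.sum_eq_single j (by simp +contextual)]
      simp)
    (fun i l => by
      rw [hE (fun t => t.1 = i ∧ t.2.2 = l), ← hrs]
      rw [Fintype.sum_eq_single i (by simp +contextual)]
      simp)
  obtain ⟨c, hc, hcr', hcs'⟩ := exists_refinement (fun e : E => e.1.2.1) r
    (fun e => e.1.2.2) h (fun _ => 1) h
    (fun j x => by rw [mul_one, ← hrc' x j]; simp only [and_comm])
    (fun j l => by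
      rw [hE (fun t => t.2.1 = j ∧ t.2.2 = l), ← hcs]
      refine sum_congr rfl fun i _ => ?_
      rw [Fintype.sum_eq_single j (by simp +contextual)]
      simp)
  obtain ⟨s, hs, hsr', hsc'⟩ := exists_refinement (fun e : E => e.1.2.2) r c h
    (fun _ => 1) (fun _ => 1)
    (fun l x => by rw [mul_one, ← hrs' x l]; simp only [and_comm])
    (fun l y => by rw [mul_one, ← hcs' y l]; simp only [and_comm])
  refine hasRealization_of_cells h r c s (fun x y => ?_) (fun x z => ?_) (fun y z => ?_) ?_
  · rw [← hcr' y x]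
    simp only [and_comm]
  · rw [← hsr' z x]
    simp only [and_comm]
  · rw [← hsc' z y]
    simp only [and_comm]
  · rintro ⟨⟨i, j, l⟩, t⟩ hij
    rw [hr, hc] at hij
    rw [hr, hs]
    obtain rfl : i = j := hij
    by_contra hli
    have := hdiag i l hli
    exact absurd t.2 (by simp [this])

/-- An idempotent latin square of order four. The distinct triples `(i, j, idempotentFour i j)`
form one of the two parity classes of injective triples in `Fin 4`. -/
def idempotentFour : Fin 4 → Fin 4 → Fin 4 :=
  ![![0, 2, 3, 1], ![3, 1, 0, 2], ![1, 3, 2, 0], ![2, 0, 1, 3]]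

/-- The outline of a realization with three subsquares of order `a` and one, of index `s`, of
order `m`, where `u + v = m * a`. -/
def outlineFour (s : Fin 4) (a m u v : ℕ) (i j l : Fin 4) : ℕ :=
  if i = j ∧ j = l then (if i = s then m * m else a * a)
  else if i = j ∨ j = l ∨ i = l then 0
  else if i = s ∨ j = s ∨ l = s then (if idempotentFour i j = l then u else v)
  else (if idempotentFour i j = l then a * a - v else a * a - u)

/-- Partitions with three equal parts `a` and a part at most `2 * a` have realizations. -/
theorem hasRealization_of_three_eq (s : Fin 4) (a m : ℕ) (hm : m ≤ 2 * a) :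
    HasRealization fun i => if i = s then m else a := by
  obtain ⟨u, v, huv, hu, hv⟩ : ∃ u v, u + v = m * a ∧ u ≤ a * a ∧ v ≤ a * a := by
    have : m * a ≤ 2 * (a * a) := by nlinarith
    exact ⟨m * a / 2, m * a - m * a / 2, by omega, by omega, by omega⟩
  have huv' : u + v = a * m := by rw [huv, mul_comm]
  refine hasRealization_of_outline _ (outlineFour s a m u v) ?_ ?_ ?_ ?_
  · intro i j
    fin_cases s <;> fin_cases i <;> fin_cases j <;>
      simp [Fin.sum_univ_four, outlineFour, idempotentFour] <;> omega
  · intro i l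
    fin_cases s <;> fin_cases i <;> fin_cases l <;>
      simp [Fin.sum_univ_four, outlineFour, idempotentFour] <;> omega
  · intro j l
    fin_cases s <;> fin_cases j <;> fin_cases l <;>
      simp [Fin.sum_univ_four, outlineFour, idempotentFour] <;> omega
  · intro i l hil
    simp [outlineFour, hil.symm]

open Finset in
/-- The converse of `hasRealization_of_outline`: a realization has an outline. -/
theorem HasRealization.exists_outline {k : ℕ} {h : Fin k → ℕ} (hr : HasRealization h) :
    ∃ N : Fin k → Fin k → Fin k → ℕ,
      (∀ i j, ∑ l, N i j l = h i * h j) ∧ (∀ i l, ∑ j, N i j l = h i * h l) ∧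
      (∀ j l, ∑ i, N i j l = h j * h l) ∧ ∀ i, N i i i = h i * h i := by
  obtain ⟨L, ⟨hrow, hcol⟩, R, C, S, hR, hC, hS, hRd, hCd, hSd, hsub⟩ := hr
  have hclass : ∀ X : Fin k → Finset (Fin (∑ i, h i)), (∀ i, #(X i) = h i) →
      (∀ i j, i ≠ j → Disjoint (X i) (X j)) → ∃ cls : Fin (∑ i, h i) → Fin k,
        ∀ x i, x ∈ X i ↔ cls x = i := by
    intro X hX hXd
    have huniv : univ.biUnion X = univ := by
      rw [← card_eq_iff_eq_univ, card_biUnion fun i _ j _ hij => hXd i j hij]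
      simp [hX]
    have hmem : ∀ x, ∃ i, x ∈ X i := by
      intro x
      simpa using (Finset.ext_iff.1 huniv x)
    choose cls hcls using hmem
    refine ⟨cls, fun x i => ⟨fun hx => ?_, fun hx => hx ▸ hcls x⟩⟩
    by_contra hne
    exact (disjoint_left.1 (hXd _ _ hne)) (hcls x) hx
  obtain ⟨r, hr⟩ := hclass R hR hRd
  obtain ⟨c, hc⟩ := hclass C hC hCd
  obtain ⟨s, hs⟩ := hclass S hS hSd
  have hprod : ∀ X Y : Finset (Fin (∑ i, h i)), ∀ i j, #X = h i → #Y = h j →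
      #(X ×ˢ Y) = h i * h j := by
    intro X Y i j hX hY
    rw [card_product, hX, hY]
  have hrc : ∀ i j, #{p : Fin (∑ i, h i) × Fin (∑ i, h i) | r p.1 = i ∧ c p.2 = j} =
      h i * h j := by
    intro i j
    rw [← hprod (R i) (C j) i j (hR i) (hC j)]
    congr 1
    ext p
    simp [hr, hc]
  refine ⟨fun i j l => #{p : Fin (∑ i, h i) × Fin (∑ i, h i) |
    (r p.1 = i ∧ c p.2 = j) ∧ s (L p.1 p.2) = l}, ?_, ?_, ?_, ?_⟩
  · intro i j
    rw [← hrc, card_eq_sum_card_fiberwise (f := fun p => s (L p.1 p.2)) (t := univ) (by simp)]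
    simp [filter_filter]
  · intro i l
    rw [← hprod (R i) (S l) i l (hR i) (hS l)]
    trans #{p : Fin (∑ i, h i) × Fin (∑ i, h i) | r p.1 = i ∧ s (L p.1 p.2) = l}
    · rw [card_eq_sum_card_fiberwise (f := fun p => c p.2) (t := univ) (by simp)]
      simp [filter_filter, and_right_comm]
    · apply card_bij (fun p _ => (p.1, L p.1 p.2))
      · intro p hp
        simpa [hr, hs] using hp
      · rintro ⟨x, y⟩ - ⟨x', y'⟩ - heq
        simp only [Prod.mk.injEq] at heq
        obtain ⟨rfl, heq⟩ := heq
        rw [(hrow x).1 heq]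
      · rintro ⟨x, z⟩ hp
        obtain ⟨y, rfl⟩ := (hrow x).2 z
        exact ⟨(x, y), by simpa [hr, hs] using hp, rfl⟩
  · intro j l
    rw [← hprod (C j) (S l) j l (hC j) (hS l)]
    trans #{p : Fin (∑ i, h i) × Fin (∑ i, h i) | c p.2 = j ∧ s (L p.1 p.2) = l}
    · rw [card_eq_sum_card_fiberwise (f := fun p => r p.1) (t := univ) (by simp)]
      simp only [filter_filter]
      refine sum_congr rfl fun i _ => ?_
      congr 1
      ext p
      simp only [mem_filter]
      tauto
    · apply card_bij (fun p _ => (p.2, L p.1 p.2))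
      · intro p hp
        simpa [hc, hs] using hp
      · rintro ⟨x, y⟩ - ⟨x', y'⟩ - heq
        simp only [Prod.mk.injEq] at heq
        obtain ⟨rfl, heq⟩ := heq
        rw [(hcol y).1 heq]
      · rintro ⟨y, z⟩ hp
        obtain ⟨x, rfl⟩ := (hcol y).2 z
        exact ⟨(x, y), by simpa [hc, hs] using hp, rfl⟩
  · intro i
    rw [← hrc]
    refine congrArg card (Finset.ext fun p => ?_)
    simp only [mem_filter, mem_univ, true_and, and_iff_left_iff_imp]
    rintro ⟨h1, h2⟩
    exact (hs _ _).1 (hsub i _ ((hr _ _).2 h1) _ ((hc _ _).2 h2))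

/-- If all of a sum of naturals is concentrated at `i`, the other terms vanish. -/
theorem eq_zero_of_sum_eq_single {ι : Type*} [Fintype ι] [DecidableEq ι] {f : ι → ℕ} {i j : ι}
    (hs : ∑ x, f x = f i) (hj : j ≠ i) : f j = 0 := by
  rw [Fintype.sum_eq_add_sum_compl i, Nat.add_eq_left, Finset.sum_eq_zero_iff] at hs
  exact hs j (by simpa using hj)

/-- Averaging the outline of a realization with four parts over the orders of each triple of
classes gives numbers `y m`, indexed by the omitted class. -/
theorem HasRealization.exists_symmetric_outline {a b c d : ℕ}
    (hr : HasRealization ![a, b, c, d]) :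
    ∃ y₀ y₁ y₂ y₃ : ℕ, y₂ + y₃ = 6 * (a * b) ∧ y₁ + y₃ = 6 * (a * c) ∧ y₁ + y₂ = 6 * (a * d) ∧
      y₀ + y₃ = 6 * (b * c) ∧ y₀ + y₂ = 6 * (b * d) ∧ y₀ + y₁ = 6 * (c * d) := by
  obtain ⟨N, hrc, hrs, hcs, hdiag⟩ := hr.exists_outline
  set h := ![a, b, c, d] with hh
  have hrc0 : ∀ i l, l ≠ i → N i i l = 0 := fun i l hl =>
    eq_zero_of_sum_eq_single (f := fun l => N i i l) ((hrc i i).trans (hdiag i).symm) hl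
  have hrs0 : ∀ i j, j ≠ i → N i j i = 0 := fun i j hj =>
    eq_zero_of_sum_eq_single (f := fun j => N i j i) ((hrs i i).trans (hdiag i).symm) hj
  have hcs0 : ∀ j i, i ≠ j → N i j j = 0 := fun j i hi =>
    eq_zero_of_sum_eq_single (f := fun i => N i j j) ((hcs j j).trans (hdiag j).symm) hi
  have two_terms : ∀ (f : Fin 4 → ℕ) (i j l m : Fin 4), [i, j, l, m].Nodup → f i = 0 → f j = 0 →
      f l + f m = ∑ x, f x := by
    intro f i j l m hn hi hj
    simp only [List.nodup_cons, List.mem_cons, List.not_mem_nil, or_false, not_or,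
      List.nodup_nil, and_true, not_false_eq_true] at hn
    refine (Fintype.sum_eq_add l m (by tauto) ?_).symm
    intro x hx
    obtain rfl | rfl : x = i ∨ x = j := by omega
    · exact hi
    · exact hj
  let Y : Fin 4 → Fin 4 → Fin 4 → ℕ := fun i j l =>
    N i j l + N i l j + N j i l + N j l i + N l i j + N l j i
  have hY : ∀ i j l m : Fin 4, [i, j, l, m].Nodup → Y i j l + Y i j m = 6 * (h i * h j) := by
    intro i j l m hn
    have hij : i ≠ j := by
      rintro rfl
      simp at hn
    have e1 := two_terms (fun x => N i j x) i j l m hn (hrs0 i j hij.symm) (hcs0 j i hij)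
    have e2 := two_terms (fun x => N j i x) i j l m hn (hcs0 i j hij.symm) (hrs0 j i hij)
    have e3 := two_terms (fun x => N i x j) i j l m hn (hrc0 i j hij.symm) (hcs0 j i hij)
    have e4 := two_terms (fun x => N j x i) i j l m hn (hcs0 i j hij.symm) (hrc0 j i hij)
    have e5 := two_terms (fun x => N x i j) i j l m hn (hrc0 i j hij.symm) (hrs0 j i hij)
    have e6 := two_terms (fun x => N x j i) i j l m hn (hrs0 i j hij.symm) (hrc0 j i hij)
    rw [hrc] at e1 e2
    rw [hrs] at e3 e4
    rw [hcs] at e5 e6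
    simp only [Y]
    linarith [mul_comm (h i) (h j)]
  have h01 := hY 0 1 2 3 (by decide)
  have h02 := hY 0 2 1 3 (by decide)
  have h03 := hY 0 3 1 2 (by decide)
  have h12 := hY 1 2 0 3 (by decide)
  have h13 := hY 1 3 0 2 (by decide)
  have h23 := hY 2 3 0 1 (by decide)
  simp only [Y, hh, Matrix.cons_val] at h01 h02 h03 h12 h13 h23
  refine ⟨Y 1 2 3, Y 0 2 3, Y 0 1 3, Y 0 1 2, ?_, ?_, ?_, ?_, ?_, ?_⟩ <;> simp only [Y] <;>
    omega

/-- for `h_1 ≥ h_2 ≥ h_3 ≥ h_4 > 0`, a realization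
`LS(h_1 h_2 h_3 h_4)` exists if and only if `h_1 = h_2 = h_3`, or
`h_2 = h_3 = h_4` with `h_1 ≤ 2 h_4`. -/
theorem statement13 (h₁ h₂ h₃ h₄ : ℕ) (h4pos : 0 < h₄)
    (h43 : h₄ ≤ h₃) (h32 : h₃ ≤ h₂) (h21 : h₂ ≤ h₁) :
    HasRealization ![h₁, h₂, h₃, h₄] ↔
      ((h₁ = h₂ ∧ h₂ = h₃) ∨ (h₂ = h₃ ∧ h₃ = h₄ ∧ h₁ ≤ 2 * h₄)) := by
  constructor
  · intro hreal
    obtain ⟨y₀, y₁, y₂, y₃, h01, h02, h03, h12, h13, h23⟩ := hreal.exists_symmetric_outline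
    have hA : h₁ * h₂ + h₃ * h₄ = h₁ * h₃ + h₂ * h₄ := by omega
    have hB : h₁ * h₃ + h₂ * h₄ = h₁ * h₄ + h₂ * h₃ := by omega
    obtain ⟨p, rfl⟩ := Nat.exists_eq_add_of_le h43
    obtain ⟨q, rfl⟩ := Nat.exists_eq_add_of_le h32
    obtain ⟨r, rfl⟩ := Nat.exists_eq_add_of_le h21
    have hq : q * (p + q + r) = 0 := by linarith
    have hr : r * p = 0 := by linarith
    have hq0 : q = 0 := by
      rcases Nat.mul_eq_zero.1 hq with h | h <;> omega
    subst hq0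
    rcases Nat.mul_eq_zero.1 hr with rfl | rfl
    · exact Or.inl ⟨rfl, rfl⟩
    · refine Or.inr ⟨rfl, rfl, ?_⟩
      have hle : (h₄ + 0 + 0 + r) * h₄ ≤ 2 * h₄ * h₄ := by
        simp only [add_zero] at *
        rw [mul_assoc]
        omega
      exact Nat.le_of_mul_le_mul_right hle h4pos
  · rintro (⟨rfl, rfl⟩ | ⟨rfl, rfl, hm⟩)
    · convert hasRealization_of_three_eq 3 h₁ h₄ (by omega) using 1
      ext i
      fin_cases i <;> rfl
    · convert hasRealization_of_three_eq 0 h₂ h₁ hm using 1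
      ext i
      fin_cases i <;> rfl
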